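/- Let S = {k, l, m} be three distinct edges and ω ∈ Ω an environment such that k is a direction-switching edge with respect to (l, m) on ω. Let K_1, K_2 be the endpoints of k; let λ be a geodesic on σ_k^a σ_l^a σ_m^b(ω) on which K_1 appears before K_2, and let μ be a geodesic on σ_k^a σ_l^b σ_m^a(ω) on which K_2 appears before K_1. Denote by λ⁻ the section of λ from the source to K_1, by λ⁺ the section of λ from K_2 to the sink, by μ⁻ the section of μ from the source to K_2, and by μ⁺ the section of μ from K_1 to the sink. Then either (l ∈ λ⁻ and m ∈ μ⁺) or (l ∈ λ⁺ and m ∈ μ⁻). -/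

import Mathlib

noncomputable section

/-! ### First-passage percolation model

Vertices are points of `ℤ^d`; two vertices are adjacent when their ℓ¹-distance is `1`.
For `n : ℕ`, the graph is restricted to the box `[-2n, 2n]^d`; `EdgeSet d n` is its edge
set `W_n`, and an environment `ω ∈ Ω_n = {a,b}^{W_n}` is modelled as a function
`Sym2 (Vtx d) → ℝ` whose values on `W_n` lie in `{a, b}` (`ValidEnv`).  `fppT d v n ω`
is the minimal passage time from the source `0` to the sink `n • v`. -/

abbrev Vtx (d : ℕ) : Type := Fin d → ℤ

/-- Two lattice points are adjacent when their ℓ¹ distance equals 1. -/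
def adjV {d : ℕ} (x y : Vtx d) : Prop := (∑ i, |x i - y i|) = 1

/-- A vertex lies in the box `[-2n, 2n]^d`. -/
def inBox {d : ℕ} (n : ℕ) (x : Vtx d) : Prop := ∀ i, |x i| ≤ (2 * n : ℤ)

/-- The edge set `W_n`: nearest-neighbour pairs inside the box. -/
def EdgeSet (d n : ℕ) : Set (Sym2 (Vtx d)) :=
  {e | ∃ x y : Vtx d, e = s(x, y) ∧ adjV x y ∧ inBox n x ∧ inBox n y}

/-- `p` is a path from `u` to `w` inside the box `[-2n, 2n]^d`. -/
def IsPath {d : ℕ} (n : ℕ) (u w : Vtx d) (p : List (Vtx d)) : Prop :=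
  p.Chain' adjV ∧ p.head? = some u ∧ p.getLast? = some w ∧ ∀ x ∈ p, inBox n x

/-- The passage time `T(p, ω)`: the sum of `ω_e` over the edges of `p`. -/
def pathTime {d : ℕ} (ω : Sym2 (Vtx d) → ℝ) (p : List (Vtx d)) : ℝ :=
  ((p.zip p.tail).map fun q => ω s(q.1, q.2)).sum

/-- The first-passage time `f_n(ω)`: minimal passage time from `0` to `n • v`. -/
def fppT (d : ℕ) (v : Vtx d) (n : ℕ) (ω : Sym2 (Vtx d) → ℝ) : ℝ :=
  sInf {t : ℝ | ∃ p : List (Vtx d), IsPath n 0 (fun i => (n : ℤ) * v i) p ∧ t = pathTime ω p}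

/-- A geodesic: a path from `0` to `n • v` attaining the minimal passage time. -/
def IsGeodesic (d : ℕ) (v : Vtx d) (n : ℕ) (ω : Sym2 (Vtx d) → ℝ) (p : List (Vtx d)) : Prop :=
  IsPath n 0 (fun i => (n : ℤ) * v i) p ∧ pathTime ω p = fppT d v n ω

/-- The list of edges traversed by a path. -/
def edgesOf {d : ℕ} (p : List (Vtx d)) : List (Sym2 (Vtx d)) :=
  (p.zip p.tail).map fun q => s(q.1, q.2)

/-- First-order environment derivative `∂_j φ = φ∘σ_j^b − φ∘σ_j^a`, where `σ_j^δ` sets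
coordinate `j` to `δ`. -/
def envDeriv {E : Type*} [DecidableEq E] (a b : ℝ) (j : E) (φ : (E → ℝ) → ℝ) : (E → ℝ) → ℝ :=
  fun ω => φ (Function.update ω j b) - φ (Function.update ω j a)

/-- Higher-order environment derivative `∂_S φ`, obtained by iterating the first-order
derivative over the elements of `S` (the recursion `∂_S φ = ∂_{S∖{j}}(∂_j φ)`; the result
is independent of the order). -/
def envDerivOn {E : Type*} [DecidableEq E] (a b : ℝ) (S : Finset E) (φ : (E → ℝ) → ℝ) :
    (E → ℝ) → ℝ :=
  S.toList.foldr (fun j ψ => envDeriv a b j ψ) φ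

/-- `ω ∈ Ω_n = {a,b}^{W_n}`: the environment takes only the values `a`, `b` on `W_n`. -/
def ValidEnv (d n : ℕ) (a b : ℝ) (ω : Sym2 (Vtx d) → ℝ) : Prop :=
  ∀ e ∈ EdgeSet d n, ω e = a ∨ ω e = b

theorem pt_cons_cons {d : ℕ} (ω : Sym2 (Vtx d) → ℝ) (x y : Vtx d) (t : List (Vtx d)) :
    pathTime ω (x :: y :: t) = ω s(x, y) + pathTime ω (y :: t) := by
  simp [pathTime]

theorem pt_glue {d : ℕ} (ω : Sym2 (Vtx d) → ℝ) (x : Vtx d) (s t : List (Vtx d)) :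
    pathTime ω (s ++ x :: t) = pathTime ω (s ++ [x]) + pathTime ω (x :: t) := by
  induction s with
  | nil => simp [pathTime]
  | cons y s ih =>
    cases s with
    | nil => simp [pathTime]
    | cons z s =>
      simp only [List.cons_append] at ih ⊢
      rw [pt_cons_cons, pt_cons_cons, ih]; ring

theorem path_glue {d : ℕ} (n : ℕ) (u w x : Vtx d) (s t : List (Vtx d)) :
    IsPath n u w (s ++ x :: t) ↔ IsPath n u x (s ++ [x]) ∧ IsPath n x w (x :: t) := by
  unfold IsPath
  have h1 : (s ++ x :: t).head? = (s ++ [x]).head? := by cases s <;> simp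
  have h2 : (s ++ x :: t).getLast? = (x :: t).getLast? := by
    rw [List.getLast?_append, List.getLast?_eq_some_getLast (List.cons_ne_nil x t)]; rfl
  have h3 : (s ++ x :: t).IsChain adjV ↔ (s ++ [x]).IsChain adjV ∧ (x :: t).IsChain adjV :=
    List.isChain_split
  have h4 : (∀ y ∈ s ++ x :: t, inBox n y) ↔
      (∀ y ∈ s ++ [x], inBox n y) ∧ (∀ y ∈ x :: t, inBox n y) := by
    constructor
    · intro h
      exact ⟨fun y hy => h y (by simp at hy ⊢; tauto), fun y hy => h y (by simp at hy ⊢; tauto)⟩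
    · rintro ⟨h, h'⟩ y hy
      rcases List.mem_append.1 hy with hy | hy
      · exact h y (by simp [hy])
      · exact h' y hy
  have h5 : (s ++ [x]).getLast? = some x := by simp
  have h6 : (x :: t).head? = some x := by simp
  rw [h1, h2, h4]
  constructor
  · rintro ⟨c, e, f, g, g'⟩
    exact ⟨⟨(h3.1 c).1, e, h5, g⟩, ⟨(h3.1 c).2, h6, f, g'⟩⟩
  · rintro ⟨⟨c, e, _, g⟩, ⟨c', _, f, g'⟩⟩
    exact ⟨h3.2 ⟨c, c'⟩, e, f, g, g'⟩

theorem edges_sub {d : ℕ} (n : ℕ) (p : List (Vtx d)) (hc : p.IsChain adjV)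
    (hb : ∀ x ∈ p, inBox n x) : ∀ e ∈ edgesOf p, e ∈ EdgeSet d n := by
  induction p with
  | nil => simp [edgesOf]
  | cons x p ih =>
    cases p with
    | nil => simp [edgesOf]
    | cons y p =>
      rw [List.isChain_cons_cons] at hc
      intro e he
      have : e = s(x, y) ∨ e ∈ edgesOf (y :: p) := by simpa [edgesOf] using he
      rcases this with rfl | h
      · exact ⟨x, y, rfl, hc.1, hb x (by simp), hb y (by simp)⟩
      · exact ih hc.2 (fun z hz => hb z (List.mem_cons_of_mem _ hz)) e h

theorem pt_mono {d : ℕ} (ω ω' : Sym2 (Vtx d) → ℝ) (p : List (Vtx d))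
    (h : ∀ e ∈ edgesOf p, ω e ≤ ω' e) : pathTime ω p ≤ pathTime ω' p := by
  unfold pathTime
  apply List.sum_le_sum
  intro q hq
  exact h _ (List.mem_map_of_mem hq)

theorem pt_nonneg {d : ℕ} (n : ℕ) (ω : Sym2 (Vtx d) → ℝ) (hp : ∀ e ∈ EdgeSet d n, 0 < ω e)
    (u w : Vtx d) (p : List (Vtx d)) (h : IsPath n u w p) : 0 ≤ pathTime ω p := by
  unfold pathTime
  apply List.sum_nonneg
  intro t ht
  obtain ⟨q, hq, rfl⟩ := List.mem_map.1 ht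
  exact (hp _ (edges_sub n p h.1 h.2.2.2 _ (List.mem_map_of_mem hq))).le

theorem fpp_le {d : ℕ} (v : Vtx d) (n : ℕ) (ω : Sym2 (Vtx d) → ℝ)
    (hp : ∀ e ∈ EdgeSet d n, 0 < ω e) (p : List (Vtx d))
    (h : IsPath n 0 (fun i => (n : ℤ) * v i) p) : fppT d v n ω ≤ pathTime ω p := by
  apply csInf_le
  · refine ⟨0, ?_⟩
    rintro t ⟨q, hq, rfl⟩
    exact pt_nonneg n ω hp _ _ q hq
  · exact ⟨p, h, rfl⟩

theorem geo_disj {d : ℕ} (v : Vtx d) (n : ℕ) (ω : Sym2 (Vtx d) → ℝ)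
    (hp : ∀ e ∈ EdgeSet d n, 0 < ω e) (s t : List (Vtx d))
    (h : IsGeodesic d v n ω (s ++ t)) (x : Vtx d) (hs : x ∈ s) (ht : x ∈ t) : False := by
  obtain ⟨s1, s2, rfl⟩ := List.append_of_mem hs
  obtain ⟨t1, t2, rfl⟩ := List.append_of_mem ht
  obtain ⟨hP, hT⟩ := h
  have e : (s1 ++ x :: s2) ++ (t1 ++ x :: t2) = s1 ++ x :: ((s2 ++ t1) ++ x :: t2) := by simp
  rw [e] at hP hT
  rw [pt_glue] at hT
  rw [path_glue] at hP
  obtain ⟨hA, hB⟩ := hP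
  generalize s2 ++ t1 = r at *
  rw [← List.cons_append] at hT hB
  rw [pt_glue ω x (x :: r) t2] at hT
  rw [path_glue] at hB
  have hle := fpp_le v n ω hp (s1 ++ x :: t2) ((path_glue ..).2 ⟨hA, hB.2⟩)
  rw [pt_glue] at hle
  have hpos : 0 < pathTime ω (x :: r ++ [x]) := by
    have hB1 := hB.1
    obtain ⟨y, r', hr⟩ : ∃ y r', r ++ [x] = y :: r' := by
      cases r with
      | nil => exact ⟨_, _, rfl⟩
      | cons y r => exact ⟨_, _, rfl⟩
    rw [List.cons_append, hr] at hB1 ⊢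
    have := (path_glue n x x y [x] r').1 hB1
    have h1 := pt_nonneg n ω hp _ _ _ this.2
    have h2 := hp _ (edges_sub n _ hB1.1 hB1.2.2.2 s(x, y) (by simp [edgesOf]))
    rw [pt_cons_cons]; linarith
  linarith

theorem edge_vtx {d : ℕ} (x y : Vtx d) (p : List (Vtx d)) (h : s(x, y) ∈ edgesOf p) :
    x ∈ p := by
  obtain ⟨⟨a, b⟩, hq, he⟩ := List.mem_map.1 h
  have h1 := List.of_mem_zip hq
  have h2 := List.mem_of_mem_tail h1.2
  rcases Sym2.eq_iff.1 he with ⟨h, _⟩ | ⟨_, h⟩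
  · exact h ▸ h1.1
  · exact h ▸ h2

theorem geo_edge_disj {d : ℕ} (v : Vtx d) (n : ℕ) (ω : Sym2 (Vtx d) → ℝ)
    (hp : ∀ e ∈ EdgeSet d n, 0 < ω e) (s t : List (Vtx d)) (A B : Vtx d)
    (h : IsGeodesic d v n ω (s ++ A :: B :: t)) (e : Sym2 (Vtx d))
    (hs : e ∈ edgesOf (s ++ [A])) (ht : e ∈ edgesOf (B :: t)) : False := by
  induction e with
  | _ x y =>
  refine geo_disj v n ω hp (s ++ [A]) (B :: t) (by simpa using h) x
    (edge_vtx _ _ _ hs) (edge_vtx _ _ _ ht)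

/-- The comparison of both geodesics `s A B t` and `s' B A t'` on an environment where the
first is optimal. -/
theorem geo_cmp {d : ℕ} (v : Vtx d) (n : ℕ) (ω : Sym2 (Vtx d) → ℝ)
    (hp : ∀ e ∈ EdgeSet d n, 0 < ω e) (s t s' t' : List (Vtx d)) (A B : Vtx d)
    (h : IsGeodesic d v n ω (s ++ A :: B :: t))
    (h' : IsPath n 0 (fun i => (n : ℤ) * v i) (s' ++ B :: A :: t')) :
    pathTime ω (B :: t) + ω s(A, B) ≤ pathTime ω (A :: t') ∧
    pathTime ω (s ++ [A]) + ω s(A, B) ≤ pathTime ω (s' ++ [B]) := by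
  obtain ⟨hP, hT⟩ := h
  rw [pt_glue, pt_cons_cons] at hT
  rw [path_glue] at hP h'
  have p1 := (path_glue n A _ B [A] t).1 hP.2
  have p2 := (path_glue n B _ A [B] t').1 h'.2
  have l1 := fpp_le v n ω hp _ ((path_glue ..).2 ⟨hP.1, p2.2⟩)
  have l2 := fpp_le v n ω hp _ ((path_glue ..).2 ⟨h'.1, p1.2⟩)
  rw [pt_glue] at l1 l2
  constructor <;> linarith

/--
Let `S = {k, l, m}` be three distinct edges of `W_n` and `ω ∈ Ω_n` such
that `k` (with endpoints `K₁`, `K₂`) is a direction-switching edge with respect to `(l, m)`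
on `ω`: concretely, let `lam = p₁ ++ K₁ :: K₂ :: p₂` be a geodesic on
`σ_k^a σ_l^a σ_m^b(ω)` traversing `k` from `K₁` to `K₂`, and let
`mu = q₁ ++ K₂ :: K₁ :: q₂` be a geodesic on `σ_k^a σ_l^b σ_m^a(ω)` traversing `k` from
`K₂` to `K₁`.  With `λ⁻ = p₁ ++ [K₁]`, `λ⁺ = K₂ :: p₂`, `μ⁻ = q₁ ++ [K₂]`,
`μ⁺ = K₁ :: q₂`, either (`l ∈ λ⁻` and `m ∈ μ⁺`) or (`l ∈ λ⁺` and `m ∈ μ⁻`).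
-/
theorem direction_switch_configuration (d : ℕ) (hd : 2 ≤ d) (a b : ℝ) (ha : 0 < a)
    (hab : a < b) (v : Vtx d) (hv : ∀ i, |v i| ≤ 2) (n : ℕ)
    (K₁ K₂ : Vtx d) (k l m : Sym2 (Vtx d)) (hkdef : k = s(K₁, K₂))
    (hk : k ∈ EdgeSet d n) (hl : l ∈ EdgeSet d n) (hm : m ∈ EdgeSet d n)
    (hkl : k ≠ l) (hkm : k ≠ m) (hlm : l ≠ m)
    (ω : Sym2 (Vtx d) → ℝ) (hω : ValidEnv d n a b ω)
    (p₁ p₂ q₁ q₂ : List (Vtx d))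
    (hlam : IsGeodesic d v n
      (Function.update (Function.update (Function.update ω m b) l a) k a)
      (p₁ ++ K₁ :: K₂ :: p₂))
    (hmu : IsGeodesic d v n
      (Function.update (Function.update (Function.update ω m a) l b) k a)
      (q₁ ++ K₂ :: K₁ :: q₂)) :
    (l ∈ edgesOf (p₁ ++ [K₁]) ∧ m ∈ edgesOf (K₁ :: q₂)) ∨
    (l ∈ edgesOf (K₂ :: p₂) ∧ m ∈ edgesOf (q₁ ++ [K₂])) := by
  have hp1 : ∀ e ∈ EdgeSet d n,
      0 < Function.update (Function.update (Function.update ω m b) l a) k a e := by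
    intro e he
    simp only [Function.update_apply]
    rcases hω e he with h | h <;> split_ifs <;> linarith
  have hp2 : ∀ e ∈ EdgeSet d n,
      0 < Function.update (Function.update (Function.update ω m a) l b) k a e := by
    intro e he
    simp only [Function.update_apply]
    rcases hω e he with h | h <;> split_ifs <;> linarith
  have m1 : ∀ e, e ≠ l → Function.update (Function.update (Function.update ω m a) l b) k a e ≤
      Function.update (Function.update (Function.update ω m b) l a) k a e := by
    intro e he
    simp only [Function.update_apply, if_neg he]
    split_ifs <;> linarith
  have m2 : ∀ e, e ≠ m → Function.update (Function.update (Function.update ω m b) l a) k a e ≤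
      Function.update (Function.update (Function.update ω m a) l b) k a e := by
    intro e he
    simp only [Function.update_apply, if_neg he]
    split_ifs <;> linarith
  have k1 : Function.update (Function.update (Function.update ω m b) l a) k a s(K₁, K₂) = a := by
    simp [hkdef]
  have k2 : Function.update (Function.update (Function.update ω m a) l b) k a s(K₂, K₁) = a := by
    simp [hkdef, Sym2.eq_swap]
  generalize Function.update (Function.update (Function.update ω m b) l a) k a = ω1 at *
  generalize Function.update (Function.update (Function.update ω m a) l b) k a = ω2 at *
  obtain ⟨c1, c2⟩ := geo_cmp v n ω1 hp1 _ _ _ _ _ _ hlam hmu.1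
  obtain ⟨c3, c4⟩ := geo_cmp v n ω2 hp2 _ _ _ _ _ _ hmu hlam.1
  have L : ∀ p, l ∉ edgesOf p → pathTime ω2 p ≤ pathTime ω1 p := fun p h =>
    pt_mono _ _ _ fun e he => m1 e (fun h' => h (h' ▸ he))
  have M : ∀ p, m ∉ edgesOf p → pathTime ω1 p ≤ pathTime ω2 p := fun p h =>
    pt_mono _ _ _ fun e he => m2 e (fun h' => h (h' ▸ he))
  have d1 : m ∈ edgesOf (K₁ :: q₂) ∨ l ∈ edgesOf (K₂ :: p₂) := by
    by_contra! h
    have := L _ h.2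
    have := M _ h.1
    linarith
  have d2 : m ∈ edgesOf (q₁ ++ [K₂]) ∨ l ∈ edgesOf (p₁ ++ [K₁]) := by
    by_contra! h
    have := L _ h.2
    have := M _ h.1
    linarith
  have x1 := geo_edge_disj v n ω1 hp1 _ _ _ _ hlam l
  have x2 := geo_edge_disj v n ω2 hp2 _ _ _ _ hmu m
  tauto

end
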